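/- Let u, v : ℝ × ℝ → ℝ be smooth functions of (x,t) solving the generalized Riemann equation at N=2, i.e. u_t = 2u·u_x − 2v and v_t = 2u·v_x, with v_x nowhere zero. Let γ : ℝ × ℝ → ℝ be any smooth function and c ∈ ℝ a constant such that ∂_t γ = 2u·∂_x γ + c at every point. Then the function γ̃ = v_x^{−1}·∂_x γ satisfies ∂_t γ̃ = 2u·∂_x γ̃ at every point. -/

import Mathlib

/-- Partial derivative with respect to the first variable `x`. -/
noncomputable def pdx (f : ℝ × ℝ → ℝ) (p : ℝ × ℝ) : ℝ := deriv (fun x => f (x, p.2)) p.1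

/-- Partial derivative with respect to the second variable `t`. -/
noncomputable def pdt (f : ℝ × ℝ → ℝ) (p : ℝ × ℝ) : ℝ := deriv (fun t => f (p.1, t)) p.2

theorem hasDerivAt_slice_fst {f : ℝ × ℝ → ℝ} {p : ℝ × ℝ} (hf : DifferentiableAt ℝ f p) :
    HasDerivAt (fun x => f (x, p.2)) (fderiv ℝ f p (1, 0)) p.1 :=
  HasFDerivAt.comp_hasDerivAt (f := fun x => (x, p.2)) p.1 hf.hasFDerivAt
    ((hasDerivAt_id p.1).prodMk (hasDerivAt_const p.1 p.2))

theorem hasDerivAt_slice_snd {f : ℝ × ℝ → ℝ} {p : ℝ × ℝ} (hf : DifferentiableAt ℝ f p) :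
    HasDerivAt (fun t => f (p.1, t)) (fderiv ℝ f p (0, 1)) p.2 :=
  HasFDerivAt.comp_hasDerivAt (f := fun t => (p.1, t)) p.2 hf.hasFDerivAt
    ((hasDerivAt_const p.2 p.1).prodMk (hasDerivAt_id p.2))

theorem hasDerivAt_pdx {f : ℝ × ℝ → ℝ} {p : ℝ × ℝ} (hf : DifferentiableAt ℝ f p) :
    HasDerivAt (fun x => f (x, p.2)) (pdx f p) p.1 :=
  (hasDerivAt_slice_fst hf).differentiableAt.hasDerivAt

theorem hasDerivAt_pdt {f : ℝ × ℝ → ℝ} {p : ℝ × ℝ} (hf : DifferentiableAt ℝ f p) :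
    HasDerivAt (fun t => f (p.1, t)) (pdt f p) p.2 :=
  (hasDerivAt_slice_snd hf).differentiableAt.hasDerivAt

theorem pdx_eq_fderiv {f : ℝ × ℝ → ℝ} (hf : Differentiable ℝ f) :
    pdx f = fun p => fderiv ℝ f p (1, 0) :=
  funext fun p => (hasDerivAt_slice_fst (hf p)).deriv

theorem pdt_eq_fderiv {f : ℝ × ℝ → ℝ} (hf : Differentiable ℝ f) :
    pdt f = fun p => fderiv ℝ f p (0, 1) :=
  funext fun p => (hasDerivAt_slice_snd (hf p)).deriv

theorem differentiable_pdx {f : ℝ × ℝ → ℝ} (hf : ContDiff ℝ 2 f) : Differentiable ℝ (pdx f) := by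
  rw [pdx_eq_fderiv (hf.differentiable (by norm_num))]
  exact ((hf.fderiv_right (m := 1) (by norm_num)).differentiable (by norm_num)).clm_apply
    (differentiable_const _)

/-- Mixed partial derivatives of a `C²` function commute. -/
theorem pdt_pdx_comm {f : ℝ × ℝ → ℝ} (hf : ContDiff ℝ 2 f) (p : ℝ × ℝ) :
    pdt (pdx f) p = pdx (pdt f) p := by
  have hd : Differentiable ℝ f := hf.differentiable (by norm_num)
  have hd' : Differentiable ℝ (fderiv ℝ f) :=
    (hf.fderiv_right (m := 1) (by norm_num)).differentiable (by norm_num)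
  have happly (w : ℝ × ℝ) : Differentiable ℝ fun q => fderiv ℝ f q w :=
    hd'.clm_apply (differentiable_const w)
  have hsecond (w z : ℝ × ℝ) :
      fderiv ℝ (fun q => fderiv ℝ f q w) p z = fderiv ℝ (fderiv ℝ f) p z w := by
    rw [fderiv_clm_apply (hd' p) (differentiableAt_const w)]
    simp
  rw [pdx_eq_fderiv hd, pdt_eq_fderiv hd, pdx_eq_fderiv (happly _), pdt_eq_fderiv (happly _)]
  simp only [hsecond]
  exact hf.contDiffAt.isSymmSndFDerivAt (by simp) (0, 1) (1, 0)

/-- The evolution of `pdx g` when `g` is transported along `2 u` with a constant source. -/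
theorem pdt_pdx_of_transport {u g : ℝ × ℝ → ℝ} {c : ℝ} (hu : Differentiable ℝ u)
    (hg : ContDiff ℝ 2 g) (hev : ∀ p, pdt g p = 2 * u p * pdx g p + c) (p : ℝ × ℝ) :
    pdt (pdx g) p = 2 * pdx u p * pdx g p + 2 * u p * pdx (pdx g) p := by
  rw [pdt_pdx_comm hg, funext hev]
  exact ((((hasDerivAt_pdx (hu p)).const_mul 2).mul
    (hasDerivAt_pdx (differentiable_pdx hg p))).add_const c).deriv

theorem riemannN2_inductive_step (u v γ : ℝ × ℝ → ℝ) (c : ℝ)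
    (hu : ContDiff ℝ (⊤ : ℕ∞) u) (hv : ContDiff ℝ (⊤ : ℕ∞) v)
    (hequ : ∀ p : ℝ × ℝ, pdt u p = 2 * u p * pdx u p - 2 * v p)
    (heqv : ∀ p : ℝ × ℝ, pdt v p = 2 * u p * pdx v p)
    (hvx : ∀ p : ℝ × ℝ, pdx v p ≠ 0)
    (hγ : ContDiff ℝ (⊤ : ℕ∞) γ)
    (hγev : ∀ p : ℝ × ℝ, pdt γ p = 2 * u p * pdx γ p + c) :
    ∀ p : ℝ × ℝ,
      pdt (fun q => (pdx v q)⁻¹ * pdx γ q) p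
        = 2 * u p * pdx (fun q => (pdx v q)⁻¹ * pdx γ q) p := by
  intro p
  have hdu : Differentiable ℝ u := hu.differentiable (by simp)
  have hv2 : ContDiff ℝ 2 v := contDiff_infty.mp hv 2
  have hγ2 : ContDiff ℝ 2 γ := contDiff_infty.mp hγ 2
  have hdv := differentiable_pdx hv2 p
  have hdγ := differentiable_pdx hγ2 p
  have hv_t := pdt_pdx_of_transport (c := 0) hdu hv2 (by simpa using heqv) p
  have hγ_t := pdt_pdx_of_transport hdu hγ2 hγev p
  have ht : pdt (fun q => (pdx v q)⁻¹ * pdx γ q) p = _ :=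
    (((hasDerivAt_pdt hdv).fun_inv (hvx p)).mul (hasDerivAt_pdt hdγ)).deriv
  have hx : pdx (fun q => (pdx v q)⁻¹ * pdx γ q) p = _ :=
    (((hasDerivAt_pdx hdv).fun_inv (hvx p)).mul (hasDerivAt_pdx hdγ)).deriv
  have hne := hvx p
  rw [ht, hx, hv_t, hγ_t]
  field_simp
  ring
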